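/- arXiv:2509.24098 — 12 statements merged into one kernel-verified Lean document; each statement's English description precedes it below -/
import Mathlib

section
/- Let (X, ▷) be a risack. Then for every x ∈ X, the element x ▷ x is a right identity element of X: for all a ∈ X, a ▷ (x ▷ x) = a. -/
/-- In a risack `(X, ▷)`, for every `x` the element `x ▷ x` is a right
identity: `a ▷ (x ▷ x) = a` for all `a`. -/
theorem stmt_2 (X : Type*) (op : X → X → X)
    (hrq : ∀ x : X, Function.Bijective (fun y : X => op y x))
    (hrisack : ∀ x y z : X, op y z = op (op y x) (op z x)) :
    ∀ x a : X, op a (op x x) = a := by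
  intro x a
  obtain ⟨b, rfl⟩ := (hrq x).surjective a
  exact (hrisack x b x).symm
end

section
/- Let (X, ▷) be a nonempty, faithful risack. Then X contains a unique right identity element e (i.e. a unique element e with a ▷ e = a for all a ∈ X), and moreover e = x ▷ x for every x ∈ X. -/
/-- A nonempty, faithful risack `(X, ▷)` contains a unique right identity
element `e`, and moreover `e = x ▷ x` for every `x ∈ X`. -/
theorem stmt_3 (X : Type*) [Nonempty X] (op : X → X → X)
    (hrq : ∀ x : X, Function.Bijective (fun y : X => op y x))
    (hrisack : ∀ x y z : X, op y z = op (op y x) (op z x))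
    (hfaithful : ∀ x x' : X, (∀ y : X, op y x = op y x') → x = x') :
    ∃ e : X, (∀ a : X, op a e = a) ∧
      (∀ e' : X, (∀ a : X, op a e' = a) → e' = e) ∧
      (∀ x : X, op x x = e) := by
  have right_id (x a : X) : op a (op x x) = a := by
    obtain ⟨y, rfl⟩ := (hrq x).surjective a
    exact (hrisack x y x).symm
  have unique (e e' : X) (he : ∀ a, op a e = a) (he' : ∀ a, op a e' = a) : e = e' :=
    hfaithful e e' fun y => (he y).trans (he' y).symm
  obtain ⟨x₀⟩ := ‹Nonempty X›
  exact ⟨op x₀ x₀, right_id x₀, fun e' he' => unique _ _ he' (right_id x₀),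
    fun x => unique _ _ (right_id x) (right_id x₀)⟩
end

section
/- Let (X, ▷) be a rack, i.e. a right quasigroup satisfying (y ▷ z) ▷ x = (y ▷ x) ▷ (z ▷ x) for all x, y, z ∈ X. Then (X, ▷) satisfies the risack axiom y ▷ z = (y ▷ x) ▷ (z ▷ x) for all x, y, z ∈ X if and only if (X, ▷) is a trivial quandle, i.e. y ▷ x = y for all x, y ∈ X. -/
/-- A rack `(X, ▷)` (right quasigroup with
`(y ▷ z) ▷ x = (y ▷ x) ▷ (z ▷ x)`) satisfies the risack axiom
`y ▷ z = (y ▷ x) ▷ (z ▷ x)` iff it is a trivial quandle (`y ▷ x = y` for all `x, y`). -/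
theorem stmt_4 (X : Type*) (op : X → X → X)
    (hrq : ∀ x : X, Function.Bijective (fun y : X => op y x))
    (hrack : ∀ x y z : X, op (op y z) x = op (op y x) (op z x)) :
    (∀ x y z : X, op y z = op (op y x) (op z x)) ↔ (∀ x y : X, op y x = y) := by
  constructor
  · intro h x w
    obtain ⟨y, rfl⟩ := (hrq x).surjective w
    exact (hrack x y x).trans (h x y x).symm
  · intro h x y z
    simp only [h]
end

section
/- Let (X, ▷) be a risack. Then for every x ∈ X, x = (x ▷ x) ▷ ((x ▷ x) ▷ x). In particular, every risack is a risandle, so the risandle axiom x = (x ▷ x) ▷ ((x ▷ x) ▷ x) is redundant given the risack axiom. -/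
/-- Every risack satisfies the risandle axiom
`x = (x ▷ x) ▷ ((x ▷ x) ▷ x)`; hence every risack is a risandle and the risandle axiom
is redundant given the risack axiom. -/
theorem stmt_5 (X : Type*) (op : X → X → X)
    (hrq : ∀ x : X, Function.Bijective (fun y : X => op y x))
    (hrisack : ∀ x y z : X, op y z = op (op y x) (op z x)) :
    ∀ x : X, x = op (op x x) (op (op x x) x) := by
  intro x
  obtain ⟨w, hw⟩ := (hrq x).2 x
  have hw : op w x = x := hw
  calc x = op w x := hw.symm
    _ = op (op w x) (op x x) := hrisack x w x
    _ = op x (op x x) := by rw [hw]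
    _ = op (op x x) (op (op x x) x) := hrisack x x (op x x)
end

section
/- Let (X, ▷) be a risack. Then for every x ∈ X, the right translation by (x ▷ x) ▷ x is the inverse of the right translation by x: for all a ∈ X, (a ▷ x) ▷ ((x ▷ x) ▷ x) = a. -/
/-- In a risack `(X, ▷)`, for every `x` the right translation by
`(x ▷ x) ▷ x` is the inverse of the right translation by `x`:
`(a ▷ x) ▷ ((x ▷ x) ▷ x) = a` for all `a`. -/
theorem stmt_6 (X : Type*) (op : X → X → X)
    (hrq : ∀ x : X, Function.Bijective (fun y : X => op y x))
    (hrisack : ∀ x y z : X, op y z = op (op y x) (op z x)) :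
    ∀ x a : X, op (op a x) (op (op x x) x) = a := by
  intro x a
  obtain ⟨b, rfl⟩ := (hrq x).surjective a
  -- both sides reduce to `a ▷ (x ▷ x) = a`, which holds because `a = b ▷ x`
  exact (hrisack x (op b x) (op x x)).symm.trans (hrisack x b x).symm
end

section
/- Let (X, ▷) be a nonempty risandle with right translation permutations s_x ∈ Perm(X). Then the set {s_x : x ∈ X} of right translations is a subgroup of Perm(X); consequently the right multiplication group RMult(X), defined as the subgroup of Perm(X) generated by {s_x : x ∈ X}, equals {s_x : x ∈ X} as a set. -/
/-- For a nonempty risandle `(X, ▷)` with right translation permutations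
`s x ∈ Perm X`, the set `{s x : x ∈ X}` is a subgroup of `Perm X`, and consequently the
right multiplication group `RMult X = Subgroup.closure (Set.range s)` coincides with
`Set.range s` as a set. -/
theorem stmt_7 (X : Type*) [Nonempty X] (op : X → X → X) (s : X → Equiv.Perm X)
    (hs : ∀ x y : X, s x y = op y x)
    (hrisack : ∀ x y z : X, op y z = op (op y x) (op z x)) :
    (∃ H : Subgroup (Equiv.Perm X), (H : Set (Equiv.Perm X)) = Set.range s) ∧
    ((Subgroup.closure (Set.range s) : Subgroup (Equiv.Perm X)) : Set (Equiv.Perm X)) =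
      Set.range s := by
  have hdiv : ∀ x z : X, s z * (s x)⁻¹ = s (s x z) := fun x z ↦ by
    rw [mul_inv_eq_iff_eq_mul]
    ext y
    simp only [Equiv.Perm.mul_apply, hs]
    exact hrisack x y z
  let H : Subgroup (Equiv.Perm X) := Subgroup.ofDiv (Set.range s) (Set.range_nonempty s) (by
    rintro _ ⟨z, rfl⟩ _ ⟨x, rfl⟩
    exact ⟨s x z, (hdiv x z).symm⟩)
  have hH : (H : Set (Equiv.Perm X)) = Set.range s := rfl
  refine ⟨⟨H, hH⟩, ?_⟩
  rw [← hH, Subgroup.closure_eq]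
end

section
/- Let (X, ▷) be a nonempty risandle with right translation permutations s_x ∈ Perm(X). Then (X, ▷) is faithful if and only if the map x ↦ s_x is a bijection from X onto the right multiplication group RMult(X). Moreover, in the faithful case this bijection is a risandle isomorphism from (X, ▷) onto the risandle (RMult(X), σ ▷ τ := σ ∘ τ⁻¹): for all x, y ∈ X, s_{y ▷ x} = s_y ∘ s_x⁻¹. -/
/-- A nonempty subset of a group that is closed under `(a, b) ↦ a * b⁻¹` is a subgroup. -/
theorem Set.eq_coe_closure_of_mul_inv_mem {G : Type*} [Group G] {S : Set G} (hne : S.Nonempty)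
    (hS : ∀ a ∈ S, ∀ b ∈ S, a * b⁻¹ ∈ S) : S = (Subgroup.closure S : Set G) := by
  refine Set.Subset.antisymm Subgroup.subset_closure fun g hg => ?_
  have one_mem : (1 : G) ∈ S := by
    obtain ⟨a, ha⟩ := hne
    simpa using hS a ha a ha
  have inv_mem : ∀ b ∈ S, b⁻¹ ∈ S := fun b hb => by simpa using hS 1 one_mem b hb
  induction hg using Subgroup.closure_induction with
  | mem x hx => exact hx
  | one => exact one_mem
  | mul x y _ _ hx hy => simpa using hS x hx y⁻¹ (inv_mem y hy)
  | inv x _ hx => exact inv_mem x hx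

/-- In a risandle, right translations satisfy `s (y ▷ x) = s y * (s x)⁻¹`. -/
theorem risandle_translation_op {X : Type*} (op : X → X → X) (s : X → Equiv.Perm X)
    (hs : ∀ x y : X, s x y = op y x)
    (hrisack : ∀ x y z : X, op y z = op (op y x) (op z x)) (x y : X) :
    s (op y x) = s y * (s x)⁻¹ := by
  refine eq_mul_inv_of_mul_eq (Equiv.ext fun w => ?_)
  rw [Equiv.Perm.mul_apply, hs, hs, hs]
  exact (hrisack x w y).symm

/-- A nonempty risandle `(X, ▷)` is faithful iff `x ↦ s x` is a bijection
from `X` onto the right multiplication group `RMult X = Subgroup.closure (Set.range s)`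
(i.e. `s` is injective and its range is exactly the carrier of `RMult X`); moreover in
the faithful case `s` is a risandle isomorphism onto `(RMult X, σ ▷ τ := σ * τ⁻¹)`:
`s (y ▷ x) = s y * (s x)⁻¹` for all `x, y`. -/
theorem stmt_8 (X : Type*) [Nonempty X] (op : X → X → X) (s : X → Equiv.Perm X)
    (hs : ∀ x y : X, s x y = op y x)
    (hrisack : ∀ x y z : X, op y z = op (op y x) (op z x)) :
    (Function.Injective s ↔
      (Function.Injective s ∧
        Set.range s =
          ((Subgroup.closure (Set.range s) : Subgroup (Equiv.Perm X)) :
            Set (Equiv.Perm X)))) ∧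
    (Function.Injective s → ∀ x y : X, s (op y x) = s y * (s x)⁻¹) := by
  have key := risandle_translation_op op s hs hrisack
  refine ⟨⟨fun hinj => ⟨hinj, ?_⟩, And.left⟩, fun _ => key⟩
  refine Set.eq_coe_closure_of_mul_inv_mem (Set.range_nonempty s) ?_
  rintro _ ⟨y, rfl⟩ _ ⟨x, rfl⟩
  exact ⟨op y x, key x y⟩
end

section
/- Every faithful risandle (X, ▷) is a quasigroup: for every y ∈ X, the left multiplication map x ↦ y ▷ x is a bijection of X. -/
/-- Every faithful risandle is a quasigroup: each left multiplication map
`x ↦ y ▷ x` is a bijection of `X`. -/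
theorem stmt_9 (X : Type*) (op : X → X → X)
    (hrq : ∀ x : X, Function.Bijective (fun y : X => op y x))
    (hrisack : ∀ x y z : X, op y z = op (op y x) (op z x))
    (hfaithful : ∀ x x' : X, (∀ y : X, op y x = op y x') → x = x') :
    ∀ y : X, Function.Bijective (fun x : X => op y x) := by
  intro y
  -- The right translations embed `X` into `Equiv.Perm X`, with `op` becoming right division.
  let s : X → Equiv.Perm X := fun x => Equiv.ofBijective _ (hrq x)
  have s_inj : Function.Injective s := fun x x' h =>
    hfaithful x x' fun w => DFunLike.congr_fun h w
  have s_op (z x : X) : s (op z x) = s z * (s x)⁻¹ := by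
    rw [eq_mul_inv_iff_mul_eq]
    ext w
    exact (hrisack x w z).symm
  refine ⟨fun x x' h => s_inj ?_, fun w => ⟨op (op (op y y) w) (op (op y y) y), s_inj ?_⟩⟩
  · have h' : s (op y x) = s (op y x') := congrArg s h
    simpa [s_op] using h'
  · simp only [s_op]
    group
end

section
/- Every group is isomorphic to the right multiplication group of a faithful risandle. Concretely, for any group G, the group G is isomorphic to the subgroup of Perm(G) generated by the permutations {h ↦ h * g⁻¹ : g ∈ G}, i.e. the right multiplication group of the risandle (G, h ▷ g := h * g⁻¹). -/
/-- The right regular representation `g ↦ (h ↦ h * g⁻¹)` of a group on itself. -/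
def rightRegularHom (G : Type*) [Group G] : G →* Equiv.Perm G where
  toFun g := Equiv.mulRight g⁻¹
  map_one' := by ext; simp
  map_mul' a b := by ext; simp [mul_assoc]

theorem rightRegularHom_injective (G : Type*) [Group G] :
    Function.Injective (rightRegularHom G) := fun a b hab => by
  simpa [rightRegularHom] using DFunLike.congr_fun hab 1

theorem closure_range_mulRight_inv (G : Type*) [Group G] :
    Subgroup.closure (Set.range fun g : G => (Equiv.mulRight g⁻¹ : Equiv.Perm G)) =
      (rightRegularHom G).range :=
  Subgroup.closure_eq (rightRegularHom G).range

/-- Every group is isomorphic to the right multiplication group of a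
faithful risandle: `G` is isomorphic to the subgroup of `Perm G` generated by the
permutations `h ↦ h * g⁻¹` (the right translations of the risandle `(G, h ▷ g := h * g⁻¹)`). -/
theorem stmt_11 (G : Type*) [Group G] :
    Nonempty
      (G ≃* (Subgroup.closure
        (Set.range fun g : G => (Equiv.mulRight g⁻¹ : Equiv.Perm G)))) := by
  rw [closure_range_mulRight_inv]
  exact ⟨MonoidHom.ofInjective (rightRegularHom_injective G)⟩
end

section
/- Let (X, ▷) be a nonempty, faithful risandle with right translation permutations s_x ∈ Perm(X). Then the presented group L(X) := ⟨ e_x (x ∈ X) | e_{y ▷ x} = e_y * e_x⁻¹ ⟩, i.e. the quotient of the free group on X by the normal closure of the relators {(of (y ▷ x)) * (of x) * (of y)⁻¹ : x, y ∈ X}, is isomorphic to the right multiplication group RMult(X), the subgroup of Perm(X) generated by {s_x : x ∈ X}. In particular |L(X)| = |X|. -/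
/-- The relators of the presented group `L(X)` of a set with a binary operation. -/
abbrev risandleRelators {X : Type*} (op : X → X → X) : Set (FreeGroup X) :=
  {r | ∃ x y : X, r = FreeGroup.of (op y x) * FreeGroup.of x * (FreeGroup.of y)⁻¹}

/-- In `L(X)` the quotient of two generators is again a generator. -/
theorem presentedGroup_of_mul_inv {X : Type*} (op : X → X → X) (x y : X) :
    (PresentedGroup.of y * (PresentedGroup.of x)⁻¹ : PresentedGroup (risandleRelators op)) =
      PresentedGroup.of (op y x) := by
  have h := PresentedGroup.one_of_mem (rels := risandleRelators op) ⟨x, y, rfl⟩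
  rw [map_mul, map_mul, map_inv, mul_inv_eq_one] at h
  exact mul_inv_eq_iff_eq_mul.mpr h.symm

/-- Every element of `L(X)` is a generator. -/
theorem presentedGroup_of_surjective {X : Type*} [Nonempty X] (op : X → X → X) :
    Function.Surjective
      (PresentedGroup.of : X → PresentedGroup (risandleRelators op)) := by
  let H : Subgroup (PresentedGroup (risandleRelators op)) :=
    Subgroup.ofDiv (Set.range PresentedGroup.of) (Set.range_nonempty _) (by
      rintro _ ⟨y, rfl⟩ _ ⟨x, rfl⟩
      exact ⟨op y x, (presentedGroup_of_mul_inv op x y).symm⟩)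
  have hH : (⊤ : Subgroup _) ≤ H := by
    rw [← PresentedGroup.closure_range_of, Subgroup.closure_le]
    exact subset_rfl
  exact fun g => hH (Subgroup.mem_top g)

/-- For a nonempty, faithful risandle `(X, ▷)` with right translation
permutations `s x`, the presented group `L(X) = ⟨ e_x (x ∈ X) ∣ e_{y ▷ x} = e_y e_x⁻¹ ⟩`
is isomorphic to the right multiplication group
`RMult X = Subgroup.closure (Set.range s)`; in particular `|L(X)| = |X|`. -/
theorem stmt_12 (X : Type*) [Nonempty X] (op : X → X → X) (s : X → Equiv.Perm X)
    (hs : ∀ x y : X, s x y = op y x)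
    (hrisack : ∀ x y z : X, op y z = op (op y x) (op z x))
    (hfaithful : Function.Injective s) :
    Nonempty
      ((PresentedGroup
          {r : FreeGroup X | ∃ x y : X,
            r = FreeGroup.of (op y x) * FreeGroup.of x * (FreeGroup.of y)⁻¹}) ≃*
        (Subgroup.closure (Set.range s) : Subgroup (Equiv.Perm X))) ∧
    Nonempty
      ((PresentedGroup
          {r : FreeGroup X | ∃ x y : X,
            r = FreeGroup.of (op y x) * FreeGroup.of x * (FreeGroup.of y)⁻¹}) ≃ X) := by
  have hrel : ∀ r ∈ risandleRelators op, FreeGroup.lift s r = 1 := by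
    rintro _ ⟨x, y, rfl⟩
    simp only [map_mul, map_inv, FreeGroup.lift_apply_of, mul_inv_eq_one]
    ext z
    simp only [Equiv.Perm.mul_apply, hs]
    exact (hrisack x z y).symm
  let φ : PresentedGroup (risandleRelators op) →* Equiv.Perm X := PresentedGroup.toGroup hrel
  have hφ (x : X) : φ (PresentedGroup.of x) = s x := PresentedGroup.toGroup.of hrel
  have hsurj := presentedGroup_of_surjective op
  have hinj : Function.Injective φ := by
    intro a b hab
    obtain ⟨x, rfl⟩ := hsurj a
    obtain ⟨y, rfl⟩ := hsurj b
    rw [hφ, hφ] at hab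
    rw [hfaithful hab]
  have hrange : φ.range = Subgroup.closure (Set.range s) := by
    rw [MonoidHom.range_eq_map, ← PresentedGroup.closure_range_of, MonoidHom.map_closure,
      ← Set.range_comp]
    exact congrArg (fun f => Subgroup.closure (Set.range f)) (funext hφ)
  have hof : Function.Injective
      (PresentedGroup.of : X → PresentedGroup (risandleRelators op)) := fun x y hxy =>
    hfaithful (by rw [← hφ, ← hφ, hxy])
  exact ⟨⟨(MonoidHom.ofInjective hinj).trans (MulEquiv.subgroupCongr hrange)⟩,
    ⟨(Equiv.ofBijective _ ⟨hof, hsurj⟩).symm⟩⟩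
end

section
/- Let n be a positive integer. On ℤ/nℤ, the operation j ▷ k := j - k + 1 defines a faithful risandle with exactly n elements, and its right multiplication group (the subgroup of Perm(ℤ/nℤ) generated by the right translations j ↦ j - k + 1) is a cyclic group isomorphic to ℤ/nℤ. (This risandle realizes the fundamental risandle of the lens space L(n,1), whose right multiplication group is therefore isomorphic to π₁(L(n,1)) ≅ ℤ/nℤ.) -/
/-- Right translation, as a homomorphism from an additive commutative group to its permutations. -/
def addRightHom (A : Type*) [AddCommGroup A] : Multiplicative A →* Equiv.Perm A where
  toFun a := Equiv.addRight a.toAdd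
  map_one' := by ext; simp
  map_mul' a b := by ext x; simp [add_comm, add_left_comm]

theorem addRightHom_injective (A : Type*) [AddCommGroup A] :
    Function.Injective (addRightHom A) := fun a b h => by
  simpa [addRightHom] using DFunLike.congr_fun h 0

theorem closure_range_addRight_sub (A : Type*) [AddCommGroup A] (c : A) :
    Subgroup.closure (Set.range fun k : A => (Equiv.addRight (c - k) : Equiv.Perm A)) =
      (addRightHom A).range := by
  have h : (Set.range fun k : A => (Equiv.addRight (c - k) : Equiv.Perm A)) =
      (addRightHom A).range := by
    ext f
    constructor
    · rintro ⟨k, rfl⟩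
      exact ⟨Multiplicative.ofAdd (c - k), rfl⟩
    · rintro ⟨a, rfl⟩
      exact ⟨c - a.toAdd, by simp [addRightHom]⟩
  rw [h, Subgroup.closure_eq]

/-- For a positive integer `n`, the operation `j ▷ k := j - k + 1` on
`ℤ/nℤ` defines a faithful risandle with exactly `n` elements, and its right
multiplication group (the subgroup of `Perm (ZMod n)` generated by the right
translations `j ↦ j - k + 1 = j + (1 - k)`) is cyclic, isomorphic to `ℤ/nℤ`
(which is `π₁` of the lens space `L(n,1)`). -/
theorem stmt_13 (n : ℕ) (hn : 0 < n) :
    (∀ k : ZMod n, Function.Bijective (fun j : ZMod n => j - k + 1)) ∧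
    (∀ x y z : ZMod n, y - z + 1 = (y - x + 1) - (z - x + 1) + 1) ∧
    (∀ k k' : ZMod n, (∀ j : ZMod n, j - k + 1 = j - k' + 1) → k = k') ∧
    Nat.card (ZMod n) = n ∧
    IsCyclic
      (Subgroup.closure
        (Set.range fun k : ZMod n => (Equiv.addRight (1 - k) : Equiv.Perm (ZMod n)))) ∧
    Nonempty
      ((Subgroup.closure
          (Set.range fun k : ZMod n => (Equiv.addRight (1 - k) : Equiv.Perm (ZMod n)))) ≃*
        Multiplicative (ZMod n)) := by
  have e := (MonoidHom.ofInjective (addRightHom_injective (ZMod n))).symm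
  rw [← closure_range_addRight_sub (ZMod n) 1] at e
  refine ⟨fun k => ?_, fun x y z => by ring, fun k k' h => by simpa using h 0,
    Nat.card_zmod n, e.isCyclic.mpr inferInstance, ⟨e⟩⟩
  convert (Equiv.addRight (1 - k)).bijective using 2 with j
  simp only [Equiv.coe_addRight]
  ring
end

section
/- On the integers ℤ, the operation j ▷ k := j - k + 1 defines a faithful risandle, and its right multiplication group (the subgroup of Perm(ℤ) generated by the right translations j ↦ j - k + 1) is an infinite cyclic group isomorphic to ℤ. (This risandle realizes the free risandle on one generator, whose underlying set is {s_x^k(x) : k ∈ ℤ} and whose right multiplication group is isomorphic to ℤ.) -/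
/-- Translations of an additive commutative group, as a homomorphism into its permutations. -/
def translationHom (A : Type*) [AddCommGroup A] : Multiplicative A →* Equiv.Perm A where
  toFun a := Equiv.addRight a.toAdd
  map_one' := by ext; simp
  map_mul' a b := by
    ext x
    simp [add_comm, add_left_comm]

theorem translationHom_injective (A : Type*) [AddCommGroup A] :
    Function.Injective (translationHom A) := fun a b h => by
  simpa [translationHom] using congrArg (fun e : Equiv.Perm A => e 0) h

theorem closure_range_addRight_one_sub :
    Subgroup.closure (Set.range fun k : ℤ => (Equiv.addRight (1 - k) : Equiv.Perm ℤ)) =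
      (translationHom ℤ).range := by
  have h : (Set.range fun k : ℤ => (Equiv.addRight (1 - k) : Equiv.Perm ℤ)) =
      (translationHom ℤ).range := by
    ext e
    constructor
    · rintro ⟨k, rfl⟩
      exact ⟨Multiplicative.ofAdd (1 - k), rfl⟩
    · rintro ⟨a, rfl⟩
      exact ⟨1 - a.toAdd, by simp [translationHom]⟩
  rw [h, Subgroup.closure_eq]

/-- On `ℤ`, the operation `j ▷ k := j - k + 1` defines a faithful
risandle, and its right multiplication group (the subgroup of `Perm ℤ` generated by the
right translations `j ↦ j - k + 1 = j + (1 - k)`) is infinite cyclic, isomorphic to `ℤ`.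
This realizes the free risandle on one generator. -/
theorem stmt_14 :
    (∀ k : ℤ, Function.Bijective (fun j : ℤ => j - k + 1)) ∧
    (∀ x y z : ℤ, y - z + 1 = (y - x + 1) - (z - x + 1) + 1) ∧
    (∀ k k' : ℤ, (∀ j : ℤ, j - k + 1 = j - k' + 1) → k = k') ∧
    Nonempty
      ((Subgroup.closure
          (Set.range fun k : ℤ => (Equiv.addRight (1 - k) : Equiv.Perm ℤ))) ≃*
        Multiplicative ℤ) := by
  refine ⟨fun k => ⟨fun a b h => ?_, fun b => ⟨b + k - 1, ?_⟩⟩, fun x y z => by ring,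
    fun k k' h => ?_, ?_⟩
  · simpa using h
  · ring
  · simpa using h 0
  · rw [closure_range_addRight_one_sub]
    exact ⟨(MonoidHom.ofInjective (translationHom_injective ℤ)).symm⟩
end
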